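/- Let X be a graph on n vertices that contains Spider(2,2,1,1) as a subgraph and is connected, and let Y be the complement of Spider(a,b,c) where a,b,c ≥ 1 and a + b + c + 1 = n. Then FS(X,Y) is connected. -/

import Mathlib

open SimpleGraph

/-- The friends-and-strangers graph of `X` and `Y`: vertices are bijections `σ : V ≃ W`,
and `σ, φ` are adjacent iff there is an edge `{a,b}` of `X` with `{σ a, σ b}` an edge of `Y`
such that `φ` is obtained from `σ` by swapping the values at `a` and `b`. -/
def FS {V W : Type*} [DecidableEq V] (X : SimpleGraph V) (Y : SimpleGraph W) : SimpleGraph (V ≃ W) :=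
  SimpleGraph.fromRel (fun σ φ =>
    ∃ a b : V, X.Adj a b ∧ Y.Adj (σ a) (σ b) ∧ φ = (Equiv.swap a b).trans σ)

/-- `m` is the first vertex (0-indexed) of one of the legs of the spider with leg
lengths `L`, i.e. `m` is the sum of a proper prefix of `L`. -/
def legStart (L : List ℕ) (m : ℕ) : Prop :=
  ∃ t : List ℕ, t <+: L ∧ t ≠ L ∧ t.sum = m

/-- The spider graph on `Fin n` (intended for `n = L.sum + 1`) with leg lengths given by the
list `L`: vertex `n-1` is the center, and the legs occupy consecutive blocks of vertices. -/
def Spider (n : ℕ) (L : List ℕ) : SimpleGraph (Fin n) :=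
  SimpleGraph.fromRel (fun i j =>
    ((j : ℕ) = n - 1 ∧ legStart L (i : ℕ)) ∨
    ((j : ℕ) = (i : ℕ) + 1 ∧ ¬ legStart L ((i : ℕ) + 1) ∧ (i : ℕ) + 1 < n - 1))

/-- The tadpole graph on `Fin n`: a cycle on vertices `0, …, c-1` together with the
path `c-1, c, …, n-1` (0-indexed version of: edges `{k,k+1}` plus `{1,c}`). -/
def Tadpole (n c : ℕ) : SimpleGraph (Fin n) :=
  SimpleGraph.fromRel (fun i j =>
    (j : ℕ) = (i : ℕ) + 1 ∨ ((i : ℕ) = 0 ∧ (j : ℕ) = c - 1))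

/-- The path graph on `n` vertices. -/
def PathG (n : ℕ) : SimpleGraph (Fin n) :=
  SimpleGraph.fromRel (fun i j => (j : ℕ) = (i : ℕ) + 1)

/-- The cycle graph on `n` vertices. -/
def CycleG (n : ℕ) : SimpleGraph (Fin n) :=
  SimpleGraph.fromRel (fun i j =>
    (j : ℕ) = (i : ℕ) + 1 ∨ ((i : ℕ) = 0 ∧ (j : ℕ) = n - 1))

/-- Forward edges of a path `0, 1, 2, …` whose edge `{m, m+1}` is rerouted to `{k, m+1}`.
For `k ≤ m` these are the spiders with at most three legs. -/
def spiderRel (k m i j : ℕ) : Prop := (i + 1 = j ∧ i ≠ m) ∨ (i = k ∧ j = m + 1)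

instance (k m i j : ℕ) : Decidable (spiderRel k m i j) :=
  inferInstanceAs (Decidable (_ ∨ _))

/-- `force f s = f s`; the case split makes the kernel evaluate `s` first. -/
def force (f : ℕ → ℕ) : ℕ → ℕ
  | 0 => f 0
  | s + 1 => f (s + 1)

theorem force_eq (f : ℕ → ℕ) (s : ℕ) : force f s = f s := by cases s <;> rfl

/-- Bit mask of the numbers below `7 ^ j` whose base-7 digits at positions `a` and `b` are
`x` and `y`. -/
def digitMask (a b x y : ℕ) : ℕ → ℕ
  | 0 => 1
  | j + 1 => force (fun u => if j = a then u <<< (x * 7 ^ j) else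
      if j = b then u <<< (y * 7 ^ j) else
      (List.range 7).foldl (fun s d => s ||| u <<< (d * 7 ^ j)) 0) (digitMask a b x y j)

/-- The set bits of a number `s` represent assignments of persons to places `0, …, 6`, written in
base 7. Add to `s` those obtained by exchanging person `x` at `a` with person `y` at `b`. -/
def addSwaps (a b x y s : ℕ) : ℕ :=
  s ||| ((s &&& digitMask a b x y 7) <<< (y * 7 ^ a + x * 7 ^ b)) >>> (x * 7 ^ a + y * 7 ^ b)

/-- The edges of `Spider 7 [2, 2, 1, 1]`. -/
def spiderEdges : List (ℕ × ℕ) := [(0, 6), (2, 6), (4, 6), (5, 6), (0, 1), (2, 3)]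

/-- The exchanges allowed by the complement of the spider given by `k` and `m`. -/
def allowedSwaps (k m : ℕ) : List ((ℕ × ℕ) × ℕ × ℕ) :=
  (spiderEdges ×ˢ (List.range 7 ×ˢ List.range 7)).filter fun p =>
    ¬ (p.2.1 = p.2.2 ∨ spiderRel k m p.2.1 p.2.2 ∨ spiderRel k m p.2.2 p.2.1)

/-- The assignments found from the identity by ten sweeps over the allowed exchanges. -/
def reached (k m : ℕ) : ℕ :=
  (List.replicate 10 (allowedSwaps k m)).flatten.foldl
    (fun s p => force (addSwaps p.1.1 p.1.2 p.2.1 p.2.2) s)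
    (1 <<< ∑ i : Fin 7, (i : ℕ) * 7 ^ (i : ℕ))

/-- The assignments that are not injective. -/
def nonInjective : ℕ :=
  ((List.range 7 ×ˢ (List.range 7 ×ˢ List.range 7)).filter fun p => p.1 ≠ p.2.1).foldl
    (fun s p => s ||| digitMask p.1 p.2.1 p.2.2 p.2.2 7) 0

/-- The path and the three-legged spiders on seven vertices, as parameters of `spiderRel`. -/
def shapes : List (ℕ × ℕ) := [(0, 0), (1, 2), (1, 3), (2, 4)]

theorem nonInjective_or_reached :
    ∀ p ∈ shapes, nonInjective ||| reached p.1 p.2 = 2 ^ 7 ^ 7 - 1 := by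
  decide +kernel

/-- Exchange the first two legs of the spider given by `k` and `m`. -/
def flipLegs (m i : ℕ) : ℕ := if i ≤ m then m - i else i

/-- Exchange the last two legs of the spider on seven vertices given by `k` and `m`. -/
def swapLegs (k m i : ℕ) : ℕ :=
  if i ≤ k then i else if i ≤ m then i + (6 - m) else i - (m - k)

/-- The permutations of the legs of the spider on seven vertices given by `k` and `m`. -/
def legPerms (k m : ℕ) : List (ℕ → ℕ) :=
  [id, flipLegs m, swapLegs k m, flipLegs (k + 6 - m) ∘ swapLegs k m,
    swapLegs (m - k) m ∘ flipLegs m,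
    flipLegs (6 - k) ∘ swapLegs (m - k) m ∘ flipLegs m]

set_option synthInstance.maxHeartbeats 200000 in
set_option synthInstance.maxSize 1000 in
theorem exists_shape_lt : ∀ m < 6, ∀ k < m + 1, ∃ p ∈ shapes, ∃ φ ∈ legPerms k m,
    (∀ i < 7, φ i < 7) ∧ (∀ i < 7, ∀ j < 7, φ i = φ j → i = j) ∧
    ∀ i < 7, ∀ j < 7, spiderRel k m i j →
      spiderRel p.1 p.2 (φ i) (φ j) ∨ spiderRel p.1 p.2 (φ j) (φ i) := by
  decide +kernel

theorem exists_shape {k m : ℕ} (hkm : k ≤ m) : ∃ p ∈ shapes, ∃ φ : ℕ → ℕ,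
    (∀ i < 7, φ i < 7) ∧ (∀ i < 7, ∀ j < 7, φ i = φ j → i = j) ∧
    ∀ i < 7, ∀ j < 7, spiderRel k m i j →
      spiderRel p.1 p.2 (φ i) (φ j) ∨ spiderRel p.1 p.2 (φ j) (φ i) := by
  by_cases hm : m < 6
  · obtain ⟨p, hp, φ, -, h⟩ := exists_shape_lt m hm k (by omega)
    exact ⟨p, hp, φ, h⟩
  · refine ⟨(0, 0), by simp [shapes], id, fun _ h => h, fun _ _ _ _ h => h, ?_⟩
    intro i hi j hj h
    simp only [spiderRel, id] at h ⊢
    omega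

theorem testBit_digitMask {a b x y : ℕ} (hx : x < 7) (hy : y < 7) (j c : ℕ)
    (h : (digitMask a b x y j).testBit c) :
    c < 7 ^ j ∧ (a < j → c / 7 ^ a % 7 = x) ∧ (a ≠ b → b < j → c / 7 ^ b % 7 = y) := by
  induction j generalizing c with
  | zero =>
    simp only [digitMask, Nat.testBit_one_eq_true_iff_self_eq_zero] at h
    simp [h]
  | succ j ih =>
    have key : ∀ d < 7, ((digitMask a b x y j) <<< (d * 7 ^ j)).testBit c →
        c < 7 ^ (j + 1) ∧ c / 7 ^ j = d ∧ (a < j → c / 7 ^ a % 7 = x) ∧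
          (a ≠ b → b < j → c / 7 ^ b % 7 = y) := by
      intro d hd h
      rw [Nat.testBit_shiftLeft, Bool.and_eq_true, decide_eq_true_eq] at h
      obtain ⟨hc, h⟩ := h
      obtain ⟨h1, h2, h3⟩ := ih _ h
      obtain ⟨c, rfl⟩ := Nat.exists_eq_add_of_le' hc
      rw [Nat.add_sub_cancel] at h1 h2 h3
      have aux : ∀ i < j, (c + d * 7 ^ j) / 7 ^ i % 7 = c / 7 ^ i % 7 := by
        intro i hi
        obtain ⟨r, rfl⟩ := Nat.exists_eq_add_of_lt hi
        rw [show d * 7 ^ (i + r + 1) = 7 ^ i * (7 * (d * 7 ^ r)) by ring,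
          Nat.add_mul_div_left _ _ (by positivity), Nat.add_mul_mod_self_left]
      refine ⟨?_, ?_, fun ha => (aux a ha).trans (h2 ha),
        fun hab hb => (aux b hb).trans (h3 hab hb)⟩
      · rw [pow_succ]; nlinarith
      · rw [Nat.add_mul_div_right _ _ (by positivity), Nat.div_eq_of_lt h1, zero_add]
    rw [digitMask, force_eq] at h
    split_ifs at h with hja hjb
    · obtain ⟨h1, h2, -, h4⟩ := key x hx h
      subst hja
      refine ⟨h1, fun _ => by rw [h2, Nat.mod_eq_of_lt hx], fun hab hb => h4 hab (by omega)⟩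
    · obtain ⟨h1, h2, h3, -⟩ := key y hy h
      subst hjb
      exact ⟨h1, fun hb => h3 (by omega), fun _ _ => by rw [h2, Nat.mod_eq_of_lt hy]⟩
    · have : ∀ (l : List ℕ) (s : ℕ), (∀ d ∈ l, d < 7) →
          (l.foldl (fun s d => s ||| digitMask a b x y j <<< (d * 7 ^ j)) s).testBit c →
          s.testBit c ∨ ∃ d < 7, (digitMask a b x y j <<< (d * 7 ^ j)).testBit c := by
        intro l
        induction l with
        | nil => intro s _ h; exact Or.inl h
        | cons d l ihl =>
          intro s hl h
          rcases ihl _ (fun d hd => hl d (by simp [hd])) h with h | h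
          · rw [Nat.testBit_or, Bool.or_eq_true] at h
            exact h.imp id fun h => ⟨d, hl d (by simp), h⟩
          · exact Or.inr h
      rcases this _ _ (by simp) h with h | ⟨d, hd, h⟩
      · simp at h
      · obtain ⟨h1, -, h3, h4⟩ := key d hd h
        exact ⟨h1, fun _ => h3 (by omega), fun hab _ => h4 hab (by omega)⟩

/-- The number whose base-7 digits are the values of `σ`. -/
def permCode (σ : Fin 7 ≃ Fin 7) : ℕ := ∑ i : Fin 7, (σ i : ℕ) * 7 ^ (i : ℕ)

theorem permCode_digit (σ : Fin 7 ≃ Fin 7) (i : Fin 7) :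
    permCode σ / 7 ^ (i : ℕ) % 7 = σ i := by
  have h := fun j => (σ j).isLt
  have h0 := h 0
  have h1 := h 1
  have h2 := h 2
  have h3 := h 3
  have h4 := h 4
  have h5 := h 5
  have h6 := h 6
  simp only [permCode, Fin.sum_univ_seven]
  fin_cases i <;> simp <;> omega

theorem permCode_lt (σ : Fin 7 ≃ Fin 7) : permCode σ < 7 ^ 7 := by
  have h := fun j => (σ j).isLt
  have h0 := h 0
  have h1 := h 1
  have h2 := h 2
  have h3 := h 3
  have h4 := h 4
  have h5 := h 5
  have h6 := h 6
  simp only [permCode, Fin.sum_univ_seven]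
  simp
  omega

theorem permCode_injective : Function.Injective permCode := fun σ τ h => by
  ext i
  rw [← permCode_digit, ← permCode_digit, h]

theorem permCode_swap (σ : Fin 7 ≃ Fin 7) {a b : Fin 7} (hab : a ≠ b) :
    permCode ((Equiv.swap a b).trans σ) + (σ a * 7 ^ (a : ℕ) + σ b * 7 ^ (b : ℕ)) =
      permCode σ + (σ b * 7 ^ (a : ℕ) + σ a * 7 ^ (b : ℕ)) := by
  have hb : b ∈ Finset.univ.erase a := by simp [hab.symm]
  simp only [permCode]
  rw [← Finset.add_sum_erase _ _ (Finset.mem_univ a), ← Finset.add_sum_erase _ _ hb,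
    ← Finset.add_sum_erase (a := a) _ (fun i => (σ i : ℕ) * 7 ^ (i : ℕ)) (Finset.mem_univ a),
    ← Finset.add_sum_erase (a := b) _ (fun i => (σ i : ℕ) * 7 ^ (i : ℕ)) hb]
  have : ∀ i ∈ (Finset.univ.erase a).erase b,
      (((Equiv.swap a b).trans σ) i : ℕ) * 7 ^ (i : ℕ) = (σ i : ℕ) * 7 ^ (i : ℕ) := by
    intro i hi
    simp only [Finset.mem_erase, Finset.mem_univ, and_true] at hi
    simp [Equiv.swap_apply_of_ne_of_ne hi.2 hi.1]
  rw [Finset.sum_congr rfl this]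
  simp
  ring

theorem not_testBit_nonInjective (σ : Fin 7 ≃ Fin 7) :
    ¬ nonInjective.testBit (permCode σ) := by
  have : ∀ (l : List (ℕ × ℕ × ℕ)) (s : ℕ),
      (∀ p ∈ l, p.1 < 7 ∧ p.2.1 < 7 ∧ p.2.2 < 7 ∧ p.1 ≠ p.2.1) →
      (l.foldl (fun s p => s ||| digitMask p.1 p.2.1 p.2.2 p.2.2 7) s).testBit (permCode σ) →
      s.testBit (permCode σ) := by
    intro l
    induction l with
    | nil => intro s _ h; exact h
    | cons p l ih =>
      intro s hl h
      have := ih _ (fun p hp => hl p (by simp [hp])) h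
      rw [Nat.testBit_or, Bool.or_eq_true] at this
      refine this.resolve_right fun h => ?_
      obtain ⟨ha, hb, hx, hab⟩ := hl p (by simp)
      obtain ⟨-, h1, h2⟩ := testBit_digitMask hx hx _ _ h
      have h1 := h1 ha
      have h2 := h2 hab hb
      rw [← h2, permCode_digit σ ⟨_, ha⟩, permCode_digit σ ⟨_, hb⟩, ← Fin.ext_iff,
        σ.injective.eq_iff, Fin.mk.injEq] at h1
      exact hab h1
  intro h
  simpa using this _ _ (by simp +contextual) h

section

variable {V W V' W' : Type*} [DecidableEq V] [DecidableEq V']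
  {X : SimpleGraph V} {Y : SimpleGraph W} {X' : SimpleGraph V'} {Y' : SimpleGraph W'}

theorem FS_adj_iff {σ τ : V ≃ W} : (FS X Y).Adj σ τ ↔
    ∃ a b, X.Adj a b ∧ Y.Adj (σ a) (σ b) ∧ τ = (Equiv.swap a b).trans σ := by
  rw [FS, SimpleGraph.fromRel_adj]
  constructor
  · rintro ⟨-, h | ⟨a, b, hab, h, rfl⟩⟩
    · exact h
    · refine ⟨a, b, hab, by simpa using h.symm, ?_⟩
      ext x
      simp
  · rintro ⟨a, b, hab, h, rfl⟩
    refine ⟨fun he => hab.ne ?_, Or.inl ⟨a, b, hab, h, rfl⟩⟩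
    have := Equiv.congr_fun he a
    simpa using this

/-- Edge-preserving bijections of the two graphs carry connectedness over. -/
theorem FS_preconnected_of_equiv (f : V ≃ V') (e : W ≃ W')
    (hf : ∀ a b, X.Adj a b → X'.Adj (f a) (f b)) (he : ∀ x y, Y.Adj x y → Y'.Adj (e x) (e y))
    (h : (FS X Y).Preconnected) : (FS X' Y').Preconnected := by
  let F : FS X Y →g FS X' Y' :=
    { toFun := fun σ => f.symm.trans (σ.trans e)
      map_rel' := by
        intro σ τ hστ
        rw [FS_adj_iff] at hστ ⊢
        obtain ⟨a, b, hab, hy, rfl⟩ := hστ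
        refine ⟨f a, f b, hf _ _ hab, by simpa using he _ _ hy, ?_⟩
        rw [← Equiv.symm_trans_swap_trans]
        ext x
        simp [Equiv.trans_assoc] }
  have hF : ∀ σ, F (f.trans (σ.trans e.symm)) = σ := fun σ => by
    ext x
    simp [F]
  intro σ τ
  rw [← hF σ, ← hF τ]
  exact (h _ _).map F

end

theorem FS_preconnected_of_shape {p : ℕ × ℕ} (hp : p ∈ shapes) {X Y : SimpleGraph (Fin 7)}
    (hX : ∀ a b : Fin 7, ((a : ℕ), (b : ℕ)) ∈ spiderEdges → X.Adj a b)
    (hY : ∀ x y : Fin 7, x ≠ y → ¬ spiderRel p.1 p.2 x y → ¬ spiderRel p.1 p.2 y x → Y.Adj x y) :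
    (FS X Y).Preconnected := by
  have inv : ∀ (l : List ((ℕ × ℕ) × ℕ × ℕ)) (s : ℕ), (∀ q ∈ l, q ∈ allowedSwaps p.1 p.2) →
      (∀ c, s.testBit c → ∃ σ, (FS X Y).Reachable (Equiv.refl _) σ ∧ permCode σ = c) →
      ∀ c, (l.foldl (fun s p => force (addSwaps p.1.1 p.1.2 p.2.1 p.2.2) s) s).testBit c →
        ∃ σ, (FS X Y).Reachable (Equiv.refl _) σ ∧ permCode σ = c := by
    intro l
    induction l with
    | nil => intro s _ h; exact h
    | cons q l ih =>
      intro s hl hs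
      refine ih _ (fun q hq => hl q (by simp [hq])) fun c hc => ?_
      beta_reduce at hc
      rw [force_eq, addSwaps, Nat.testBit_or, Bool.or_eq_true] at hc
      rcases hc with hc | hc
      · exact hs c hc
      obtain ⟨⟨a, b⟩, x, y⟩ := q
      have hq := hl _ (List.mem_cons_self ..)
      simp only [allowedSwaps, List.mem_filter, List.mem_product, List.mem_range, not_or,
        decide_eq_true_eq] at hq
      obtain ⟨⟨hE, hx, hy⟩, hxy, h1, h2⟩ := hq
      have hlt : ∀ e ∈ spiderEdges, e.1 < 7 ∧ e.2 < 7 ∧ e.1 ≠ e.2 := by decide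
      obtain ⟨ha, hb, hab⟩ := hlt _ hE
      simp only at ha hb hab
      rw [Nat.testBit_shiftRight, Nat.testBit_shiftLeft, Nat.testBit_and, Bool.and_eq_true,
        Bool.and_eq_true, decide_eq_true_eq] at hc
      obtain ⟨hge, hc, hm⟩ := hc
      obtain ⟨-, hm1, hm2⟩ := testBit_digitMask hx hy _ _ hm
      obtain ⟨σ, hσ, hσc⟩ := hs _ hc
      simp only at hge hm1 hm2 hσc
      have hm1 := hm1 ha
      have hm2 := hm2 hab hb
      rw [← hσc, permCode_digit σ ⟨a, ha⟩] at hm1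
      rw [← hσc, permCode_digit σ ⟨b, hb⟩] at hm2
      refine ⟨(Equiv.swap ⟨a, ha⟩ ⟨b, hb⟩).trans σ, hσ.trans (Adj.reachable ?_), ?_⟩
      · refine FS_adj_iff.2 ⟨_, _, hX _ _ hE, hY _ _ ?_ ?_ ?_, rfl⟩
        · rw [Ne, Fin.ext_iff, hm1, hm2]; exact hxy
        · rw [hm1, hm2]; exact h1
        · rw [hm1, hm2]; exact h2
      · have := permCode_swap σ (a := ⟨a, ha⟩) (b := ⟨b, hb⟩) (by simpa using hab)
        rw [hm1, hm2] at this
        simp only at this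
        omega
  have all : ∀ σ, (FS X Y).Reachable (Equiv.refl _) σ := by
    intro σ
    have h := congrArg (Nat.testBit · (permCode σ)) (nonInjective_or_reached p hp)
    simp only [Nat.testBit_or, Nat.testBit_two_pow_sub_one, permCode_lt, decide_true,
      Bool.or_eq_true] at h
    obtain ⟨τ, hτ, hc⟩ := inv _ _ (by simp) (fun c hc => ⟨Equiv.refl _, Reachable.refl _, by
      rw [Nat.testBit_shiftLeft, Bool.and_eq_true, decide_eq_true_eq,
        Nat.testBit_one_eq_true_iff_self_eq_zero] at hc
      simp only [permCode, Equiv.refl_apply]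
      omega⟩) _ (h.resolve_left (not_testBit_nonInjective σ))
    exact permCode_injective hc ▸ hτ
  exact fun σ τ => (all σ).symm.trans (all τ)

section

variable {V W : Type*} [DecidableEq V] {X : SimpleGraph V} {Y : SimpleGraph W}

/-- Assignments that agree at `v` are connected once the graph without that place and person is. -/
theorem FS_reachable_of_induce {v : V} {p : W}
    (h : (FS (X.induce {x | x ≠ v}) (Y.induce {y | y ≠ p})).Preconnected)
    {σ τ : V ≃ W} (hσ : σ v = p) (hτ : τ v = p) : (FS X Y).Reachable σ τ := by
  have key : ∀ σ' τ' : {x | x ≠ v} ≃ {y | y ≠ p},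
      (FS (X.induce {x | x ≠ v}) (Y.induce {y | y ≠ p})).Reachable σ' τ' →
      ∀ σ τ : V ≃ W, σ v = p → τ v = p → (∀ x : {x | x ≠ v}, σ x = σ' x) →
        (∀ x : {x | x ≠ v}, τ x = τ' x) →
        (FS X Y).Reachable σ τ := by
    rintro σ' τ' ⟨w⟩
    induction w with
    | nil =>
      intro σ τ hσ hτ h1 h2
      have : σ = τ := by
        ext x
        by_cases hx : x = v
        · rw [hx, hσ, hτ]
        · exact (h1 ⟨x, hx⟩).trans (h2 ⟨x, hx⟩).symm
      rw [this]
    | cons hadj w ih =>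
      intro σ τ hσ hτ h1 h2
      obtain ⟨a, b, hab, hy, rfl⟩ := FS_adj_iff.1 hadj
      have step : (FS X Y).Adj σ ((Equiv.swap (a : V) b).trans σ) :=
        FS_adj_iff.2 ⟨a, b, hab, by rw [h1, h1]; exact hy, rfl⟩
      refine step.reachable.trans (ih _ _ ?_ hτ ?_ h2)
      · rw [Equiv.trans_apply, Equiv.swap_apply_of_ne_of_ne a.2.symm b.2.symm, hσ]
      · intro x
        rw [Equiv.trans_apply, Equiv.trans_apply, ← h1]
        simp only [Equiv.swap_apply_def, Subtype.ext_iff, apply_ite Subtype.val]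
  have hr : ∀ ρ : V ≃ W, ρ v = p → ∀ x, x ∈ {x | x ≠ v} ↔ ρ x ∈ {y | y ≠ p} := by
    rintro ρ rfl x
    simp
  exact key (σ.subtypeEquiv (hr σ hσ)) (τ.subtypeEquiv (hr τ hτ)) (h _ _) σ τ hσ hτ
    (fun _ => rfl) fun _ => rfl

theorem FS_preconnected_of_fibers (hY : Y.Preconnected) {u v : V} (huv : X.Adj u v)
    (h : ∀ σ τ : V ≃ W, σ v = τ v → (FS X Y).Reachable σ τ) : (FS X Y).Preconnected := by
  have key : ∀ p q, Y.Reachable p q → ∀ σ τ : V ≃ W, σ v = p → τ v = q →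
      (FS X Y).Reachable σ τ := by
    classical
    rintro p q ⟨w⟩
    induction w with
    | nil => exact fun σ τ hσ hτ => h σ τ (hσ.trans hτ.symm)
    | @cons p q' q hadj w ih =>
      intro σ τ hσ hτ
      have hρv : (σ.trans (Equiv.swap (σ u) q')) v = p := by
        rw [Equiv.trans_apply, hσ, Equiv.swap_apply_of_ne_of_ne _ hadj.ne]
        rw [← hσ]
        exact fun he => huv.ne (σ.injective he).symm
      have hρu : (σ.trans (Equiv.swap (σ u) q')) u = q' := by simp
      refine (h σ _ (hσ.trans hρv.symm)).trans (.trans (Adj.reachable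
        (FS_adj_iff.2 ⟨u, v, huv, ?_, rfl⟩)) (ih _ τ ?_ hτ))
      · rw [hρu, hρv]; exact hadj.symm
      · rw [Equiv.trans_apply, Equiv.swap_apply_right, hρu]
  exact fun σ τ => key _ _ (hY _ _) σ τ rfl rfl

end

section

variable {V W : Type*} {X : SimpleGraph V} {Y : SimpleGraph W}

/-- A vertex outside a connected set can be removed without disconnecting the graph. -/
theorem exists_connected_induce_ne [Finite V] (hX : X.Connected) {S : Set V}
    (hS : (X.induce S).Connected) (hne : S ≠ Set.univ) :
    ∃ v ∉ S, (X.induce {x | x ≠ v}).Connected := by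
  obtain ⟨U, hSU, hU⟩ := (Set.toFinite
    {U : Set V | U ≠ Set.univ ∧ (X.induce U).Connected}).exists_le_maximal ⟨hne, hS⟩
  obtain ⟨hUne, hUc⟩ := hU.prop
  obtain ⟨⟨x, hx⟩⟩ := hUc.nonempty
  obtain ⟨y, hy⟩ := (Set.ne_univ_iff_exists_notMem U).1 hUne
  obtain ⟨w⟩ := hX.preconnected x y
  obtain ⟨d, -, hd1, hd2⟩ := w.exists_boundary_dart U hx hy
  have hc : (X.induce (U ∪ {d.snd})).Connected :=
    connected_induce_union hUc.preconnected .of_subsingleton hd1 rfl d.adj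
  have huniv : U ∪ {d.snd} = Set.univ := by
    by_contra h
    exact hd2 (hU.le_of_ge ⟨h, hc⟩ Set.subset_union_left (Or.inr rfl))
  have : U = {x | x ≠ d.snd} := by
    ext z
    have hz : z ∈ U ∪ {d.snd} := huniv ▸ Set.mem_univ z
    refine ⟨fun h he => hd2 (he ▸ h), fun h => hz.resolve_right h⟩
  exact ⟨d.snd, fun h => hd2 (hSU h), this ▸ hUc⟩

theorem connected_induce_range {f : Fin 7 → V}
    (hf : ∀ a b : Fin 7, ((a : ℕ), (b : ℕ)) ∈ spiderEdges → X.Adj (f a) (f b)) :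
    (X.induce (Set.range f)).Connected := by
  have h : ∀ a b : Fin 7, ((a : ℕ), (b : ℕ)) ∈ spiderEdges →
      (X.induce (Set.range f)).Reachable ⟨f b, b, rfl⟩ ⟨f a, a, rfl⟩ :=
    fun a b hab => Adj.reachable (hf a b hab).symm
  refine (connected_iff_exists_forall_reachable _).2 ⟨⟨f 6, 6, rfl⟩, ?_⟩
  rintro ⟨_, i, rfl⟩
  fin_cases i
  · exact h 0 6 (by decide)
  · exact (h 0 6 (by decide)).trans (h 0 1 (by decide)).symm
  · exact h 2 6 (by decide)
  · exact (h 2 6 (by decide)).trans (h 2 3 (by decide)).symm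
  · exact h 4 6 (by decide)
  · exact h 5 6 (by decide)
  · exact Reachable.refl _

theorem preconnected_of_spiderRel {n k m : ℕ} (hn : 8 ≤ n) (e : W ≃ Fin n)
    (hY : ∀ x y, x ≠ y → ¬ Y.Adj x y → spiderRel k m (e x) (e y) ∨ spiderRel k m (e y) (e x)) :
    Y.Preconnected := by
  have key : ∀ (x y : W) (s : Finset ℕ), s.card ≤ 6 →
      (∀ i : Fin n, ∀ z, (z = x ∨ z = y) → ((i : ℕ) = e z ∨ spiderRel k m i (e z) ∨
        spiderRel k m (e z) i) → (i : ℕ) ∈ s) → Y.Reachable x y := by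
    intro x y s hs h
    obtain ⟨i, hi, his⟩ := Finset.exists_mem_notMem_of_card_lt_card
      (s := s) (t := Finset.range n) (by simp; omega)
    rw [Finset.mem_range] at hi
    have hadj : ∀ z, (z = x ∨ z = y) → Y.Adj z (e.symm ⟨i, hi⟩) := by
      intro z hz
      by_contra hc
      refine his (h ⟨i, hi⟩ z hz ?_)
      by_cases he : z = e.symm ⟨i, hi⟩
      · left; simp [he]
      · right
        simpa using (hY _ _ he hc).symm
    exact (hadj x (Or.inl rfl)).reachable.trans (hadj y (Or.inr rfl)).reachable.symm
  have main : ∀ x y, spiderRel k m (e x) (e y) → Y.Reachable x y := by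
    rintro x y (⟨h1, h2⟩ | ⟨h1, h2⟩)
    · refine key x y {(e x : ℕ) - 1, (e x : ℕ), (e x : ℕ) + 1, (e x : ℕ) + 2, k, m + 1}
        Finset.card_le_six ?_
      rintro i z (rfl | rfl) h <;> simp only [spiderRel, Finset.mem_insert,
        Finset.mem_singleton] at h ⊢ <;> omega
    · refine key x y {k - 1, k, k + 1, m, m + 1, m + 2} Finset.card_le_six ?_
      rintro i z (rfl | rfl) h <;> simp only [spiderRel, Finset.mem_insert,
        Finset.mem_singleton] at h ⊢ <;> omega
  intro x y
  by_cases hxy : x = y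
  · exact hxy ▸ Reachable.refl _
  by_cases h : Y.Adj x y
  · exact h.reachable
  · exact (hY x y hxy h).elim (main x y) fun h => (main y x h).symm

end

/-- Deleting a vertex of a path or three-legged spider leaves a subgraph of a smaller one. -/
theorem exists_spiderRel_of_delete {k m : ℕ} (hkm : k ≤ m) (q : ℕ) :
    ∃ k' m', k' ≤ m' ∧ ∀ i j : ℕ,
      spiderRel k m (if i < q then i else i + 1) (if j < q then j else j + 1) →
        spiderRel k' m' i j := by
  by_cases h : q = k ∧ k = m
  · refine ⟨m, m, le_rfl, fun i j h' => ?_⟩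
    simp only [spiderRel] at h' ⊢
    split_ifs at h' <;> omega
  · refine ⟨if q < k then k - 1 else k, if q ≤ m then m - 1 else m, ?_, fun i j h' => ?_⟩
    · split_ifs <;> omega
    · simp only [spiderRel] at h' ⊢
      split_ifs at h' ⊢ <;> omega

theorem FS_preconnected_of_seven {V W : Type*} [DecidableEq V] [Finite V]
    (hV : Nat.card V = 7) (e : W ≃ Fin 7)
    {X : SimpleGraph V} {Y : SimpleGraph W} {f : Fin 7 → V} (hf : Function.Injective f)
    (hfX : ∀ a b : Fin 7, ((a : ℕ), (b : ℕ)) ∈ spiderEdges → X.Adj (f a) (f b))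
    {k m : ℕ} (hkm : k ≤ m)
    (hY : ∀ x y, x ≠ y → ¬ Y.Adj x y → spiderRel k m (e x) (e y) ∨ spiderRel k m (e y) (e x)) :
    (FS X Y).Preconnected := by
  obtain ⟨p, hp, φ, hφ, hφi, hφr⟩ := exists_shape hkm
  let F : Fin 7 ≃ V := Equiv.ofBijective f
    (hf.bijective_of_nat_card_le (by simp [hV]))
  let Φ : Fin 7 ≃ Fin 7 := Equiv.ofBijective (fun i => ⟨φ i, hφ i i.2⟩)
    (Finite.injective_iff_bijective.1 fun i j h =>
      Fin.ext (hφi i i.2 j j.2 (congrArg Fin.val h)))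
  have hΦ : ∀ w, φ (e w) = Φ (e w) := fun _ => rfl
  refine FS_preconnected_of_equiv (X := X.comap F) (Y := Y.comap (e.trans Φ).symm) F
    (e.trans Φ).symm (fun _ _ h => h) (fun _ _ h => h) (FS_preconnected_of_shape hp hfX ?_)
  intro x y hxy h1 h2
  by_contra h
  obtain ⟨x, rfl⟩ := (e.trans Φ).surjective x
  obtain ⟨y, rfl⟩ := (e.trans Φ).surjective y
  simp only [comap_adj, Equiv.symm_apply_apply] at h
  rw [Equiv.trans_apply, Equiv.trans_apply, ← hΦ, ← hΦ] at h1 h2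
  rcases hY x y (fun he => hxy (he ▸ rfl)) h with h | h <;>
    rcases hφr _ (Fin.is_lt _) _ (Fin.is_lt _) h with h | h
  exacts [h1 h, h2 h, h2 h, h1 h]

theorem FS_preconnected_of_spiderRel {n : ℕ} (hn : 7 ≤ n) :
    ∀ {V W : Type} [DecidableEq V] [Finite V] (_ : Nat.card V = n) (e : W ≃ Fin n)
      {X : SimpleGraph V} {Y : SimpleGraph W} (_ : X.Connected) {f : Fin 7 → V}
      (_ : Function.Injective f)
      (_ : ∀ a b : Fin 7, ((a : ℕ), (b : ℕ)) ∈ spiderEdges → X.Adj (f a) (f b))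
      {k m : ℕ} (_ : k ≤ m)
      (_ : ∀ x y, x ≠ y → ¬ Y.Adj x y →
        spiderRel k m (e x) (e y) ∨ spiderRel k m (e y) (e x)), (FS X Y).Preconnected := by
  induction n, hn using Nat.le_induction with
  | base =>
    intro V W _ _ hV e X Y _ f hf hfX k m hkm hY
    exact FS_preconnected_of_seven hV e hf hfX hkm hY
  | succ n hn ih =>
    intro V W _ _ hV e X Y hX f hf hfX k m hkm hY
    obtain ⟨v, hv, hXv⟩ := exists_connected_induce_ne hX (connected_induce_range hfX) fun h => by
      have := Nat.card_le_card_of_surjective f (Set.range_eq_univ.1 h)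
      simp at this
      omega
    obtain ⟨w⟩ := hX.preconnected v (f 6)
    obtain ⟨d, -, hd, -⟩ := w.exists_boundary_dart {v} rfl fun h => hv ⟨6, h⟩
    obtain rfl : d.fst = v := hd
    refine FS_preconnected_of_fibers (preconnected_of_spiderRel (by omega) e hY) d.adj.symm
      fun σ τ hστ => FS_reachable_of_induce (v := d.fst) (p := τ d.fst) ?_ hστ rfl
    obtain ⟨k', m', hkm', hdel⟩ := exists_spiderRel_of_delete hkm (e (τ d.fst))
    let e' : {y | y ≠ τ d.fst} ≃ Fin n :=
      (e.subtypeEquiv (q := fun i => i ≠ e (τ d.fst)) fun y => by simp).trans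
        (finSuccAboveEquiv (e (τ d.fst))).symm
    have he' : ∀ y : {y | y ≠ τ d.fst}, (e y : ℕ) =
        if (e' y : ℕ) < e (τ d.fst) then (e' y : ℕ) else e' y + 1 := by
      intro y
      have h : (finSuccAboveEquiv (e (τ d.fst)) (e' y) : Fin (n + 1)) = e y := by
        simp [e']
      rw [← h, finSuccAboveEquiv_apply]
      simp only [Fin.succAbove, Fin.lt_def, Fin.val_castSucc]
      split_ifs <;> rfl
    refine ih ?_ e' hXv (f := fun i => ⟨f i, fun h => hv ⟨i, h⟩⟩)
      (fun i j h => hf (congrArg Subtype.val h)) hfX hkm' fun x y hxy hadj => ?_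
    · have := Fintype.ofFinite V
      rw [Nat.card_eq_fintype_card] at hV ⊢
      rw [Set.card_ne_eq, hV, Nat.add_sub_cancel]
    · have := hY x y (fun h => hxy (Subtype.ext h)) hadj
      rw [he' x, he' y] at this
      exact this.imp (hdel _ _) (hdel _ _)

theorem legStart_nil {i : ℕ} : ¬ legStart [] i := by
  simp [legStart]

theorem legStart_cons {a i : ℕ} {L : List ℕ} :
    legStart (a :: L) i ↔ i = 0 ∨ a ≤ i ∧ legStart L (i - a) := by
  simp only [legStart, List.prefix_cons_iff]
  constructor
  · rintro ⟨t, rfl | ⟨t, rfl, ht⟩, h2, rfl⟩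
    · exact Or.inl rfl
    · exact Or.inr ⟨by simp, t, ht, fun h => h2 (h ▸ rfl), by simp⟩
  · rintro (rfl | ⟨hle, t, ht, h2, hsum⟩)
    · exact ⟨[], by simp⟩
    · exact ⟨a :: t, Or.inr ⟨t, rfl, ht⟩, by simpa using h2, by rw [List.sum_cons]; omega⟩

theorem spider_adj_of_mem {i j : Fin 7} (h : ((i : ℕ), (j : ℕ)) ∈ spiderEdges) :
    (Spider 7 [2, 2, 1, 1]).Adj i j := by
  simp only [spiderEdges, List.mem_cons, Prod.mk.injEq, List.not_mem_nil, or_false] at h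
  simp only [Spider, fromRel_adj, legStart_cons, legStart_nil, Fin.ext_iff, Ne]
  rcases h with ⟨hi, hj⟩ | ⟨hi, hj⟩ | ⟨hi, hj⟩ | ⟨hi, hj⟩ | ⟨hi, hj⟩ | ⟨hi, hj⟩ <;>
    rw [hi, hj] <;> simp

/-- If a connected graph `X` on `n` vertices contains `Spider(2,2,1,1)` as a subgraph and
`Y` is the complement of `Spider(a,b,c)` with `a + b + c + 1 = n`, then `FS(X,Y)` is
connected. -/
theorem stmt12 (n a b c : ℕ) (ha : 1 ≤ a) (hb : 1 ≤ b) (hc : 1 ≤ c)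
    (hn : a + b + c + 1 = n)
    (X : SimpleGraph (Fin n)) (hX : X.Connected)
    (hsub : ∃ f : Fin 7 → Fin n, Function.Injective f ∧
      ∀ i j, (Spider 7 [2, 2, 1, 1]).Adj i j → X.Adj (f i) (f j)) :
    (FS X (Spider n [a, b, c])ᶜ).Connected := by
  subst hn
  obtain ⟨f, hf, hfX⟩ := hsub
  let label : Fin (a + b + c + 1) → Fin (a + b + c + 1) := fun i =>
    ⟨if (i : ℕ) < a then a - 1 - i else if (i : ℕ) = a + b + c then a else i + 1, by
      split_ifs <;> omega⟩
  have hlabel : Function.Injective label := by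
    intro i j h
    simp only [label, Fin.mk.injEq] at h
    ext
    split_ifs at h <;> omega
  have h7 : 7 ≤ a + b + c + 1 := by simpa using Fintype.card_le_of_injective f hf
  have := hX.nonempty
  refine (connected_iff _).2 ⟨FS_preconnected_of_spiderRel h7 (by simp)
    (Equiv.ofBijective label (Finite.injective_iff_bijective.1 hlabel)) hX hf ?_
    (Nat.le_add_right a b) ?_, ⟨Equiv.refl _⟩⟩
  · exact fun i j hij => hfX i j (spider_adj_of_mem hij)
  · intro x y hxy h
    simp only [compl_adj, not_and, not_not] at h
    have h := h hxy
    simp only [Spider, fromRel_adj, legStart_cons, legStart_nil, Nat.add_sub_cancel] at h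
    simp only [spiderRel, Equiv.ofBijective_apply, label]
    split_ifs <;> omega
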